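/- arXiv:1908.10496 — 4 statements merged into one kernel-verified Lean document; each statement's English description precedes it below -/
import Mathlib

section
/- For every φ ∈ E and every ψ ∈ Φ such that ψ ∉ E, ψ ≠ φ and ψ − φ ∉ Φ, there exists ω ∈ E such that either (ω + ψ ∈ Φ and ω + ψ ≠ φ and (ω + ψ) − φ ∉ Φ) or (ω = −ψ and ψ ≠ −φ). -/
/-- The `i`-th standard basis vector of (an ambient copy of) `ℝ^n`. -/
noncomputable def e (i : ℕ) : ℕ → ℝ := Pi.single i 1

/-- The root system of type `Cₙ`: `{eᵢ - eⱼ, eᵢ + eⱼ, -eᵢ - eⱼ : i ≠ j} ∪ {±2eᵢ}`,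
indices between `1` and `n`. -/
def PhiC (n : ℕ) : Set (ℕ → ℝ) :=
  {v | ∃ i j : ℕ, 1 ≤ i ∧ i ≤ n ∧ 1 ≤ j ∧ j ≤ n ∧ i ≠ j ∧
      (v = e i - e j ∨ v = e i + e j ∨ v = -e i - e j)} ∪
  {v | ∃ i : ℕ, 1 ≤ i ∧ i ≤ n ∧ (v = (2 : ℝ) • e i ∨ v = -((2 : ℝ) • e i))}

/-- The distinguished subset `E ⊆ Φ` of type `Cₙ`:
`{eᵢ - eⱼ : i odd, j even} ∪ {eₘ + eₚ : m ≠ p odd} ∪ {-eₖ - eₗ : k ≠ l even}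
∪ {2eₜ : t odd} ∪ {-2eₛ : s even}`, indices between `1` and `n`. -/
def EC (n : ℕ) : Set (ℕ → ℝ) :=
  {v | ∃ i j : ℕ, 1 ≤ i ∧ i ≤ n ∧ 1 ≤ j ∧ j ≤ n ∧ Odd i ∧ Even j ∧ v = e i - e j} ∪
  {v | ∃ m p : ℕ, 1 ≤ m ∧ m ≤ n ∧ 1 ≤ p ∧ p ≤ n ∧ m ≠ p ∧ Odd m ∧ Odd p ∧
      v = e m + e p} ∪
  {v | ∃ k l : ℕ, 1 ≤ k ∧ k ≤ n ∧ 1 ≤ l ∧ l ≤ n ∧ k ≠ l ∧ Even k ∧ Even l ∧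
      v = -e k - e l} ∪
  {v | ∃ t : ℕ, 1 ≤ t ∧ t ≤ n ∧ Odd t ∧ v = (2 : ℝ) • e t} ∪
  {v | ∃ s : ℕ, 1 ≤ s ∧ s ≤ n ∧ Even s ∧ v = -((2 : ℝ) • e s)}

/-- The standard basis vector `e i` with sign `+` for odd `i` and `-` for even `i`. In this basis
`EC n` consists of the sums of two basis vectors. -/
noncomputable def signedBasis (i : ℕ) : ℕ → ℝ := if Odd i then e i else -e i

lemma signedBasis_apply (i k : ℕ) :
    signedBasis i k = if i = k then (if Odd k then 1 else -1) else 0 := by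
  unfold signedBasis e
  by_cases h : i = k
  · subst h
    rw [if_pos rfl]
    split_ifs <;> simp
  · have h' : k ≠ i := fun h' => h h'.symm
    split_ifs <;> simp [h']

lemma signedBasis_add_mem_EC {n i j : ℕ} (hi : 1 ≤ i ∧ i ≤ n) (hj : 1 ≤ j ∧ j ≤ n) :
    signedBasis i + signedBasis j ∈ EC n := by
  obtain ⟨hi1, hin⟩ := hi
  obtain ⟨hj1, hjn⟩ := hj
  by_cases hij : i = j
  · subst hij
    by_cases oi : Odd i
    · refine Or.inl (Or.inr ⟨i, hi1, hin, oi, ?_⟩)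
      simp only [signedBasis, oi, if_true]
      module
    · refine Or.inr ⟨i, hi1, hin, Nat.not_odd_iff_even.mp oi, ?_⟩
      simp only [signedBasis, oi, if_false]
      module
  by_cases oi : Odd i <;> by_cases oj : Odd j
  · refine Or.inl (Or.inl (Or.inl (Or.inr ⟨i, j, hi1, hin, hj1, hjn, hij, oi, oj, ?_⟩)))
    simp [signedBasis, oi, oj]
  · refine Or.inl (Or.inl (Or.inl (Or.inl
      ⟨i, j, hi1, hin, hj1, hjn, oi, Nat.not_odd_iff_even.mp oj, ?_⟩)))
    simp only [signedBasis, oi, oj, if_true, if_false]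
    module
  · refine Or.inl (Or.inl (Or.inl (Or.inl
      ⟨j, i, hj1, hjn, hi1, hin, oj, Nat.not_odd_iff_even.mp oi, ?_⟩)))
    simp only [signedBasis, oi, oj, if_true, if_false]
    module
  · refine Or.inl (Or.inl (Or.inr ⟨i, j, hi1, hin, hj1, hjn, hij,
      Nat.not_odd_iff_even.mp oi, Nat.not_odd_iff_even.mp oj, ?_⟩))
    simp only [signedBasis, oi, oj, if_false]
    module

lemma exists_signedBasis_add_of_mem_EC {n : ℕ} {v : ℕ → ℝ} (hv : v ∈ EC n) :
    ∃ i j, (1 ≤ i ∧ i ≤ n) ∧ (1 ≤ j ∧ j ≤ n) ∧ v = signedBasis i + signedBasis j := by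
  rcases hv with (((⟨i, j, hi, hin, hj, hjn, oi, ej, rfl⟩ | ⟨i, j, hi, hin, hj, hjn, -, oi, oj, rfl⟩)
    | ⟨i, j, hi, hin, hj, hjn, -, ei, ej, rfl⟩) | ⟨i, hi, hin, oi, rfl⟩) | ⟨i, hi, hin, ei, rfl⟩
  · refine ⟨i, j, ⟨hi, hin⟩, ⟨hj, hjn⟩, ?_⟩
    simp only [signedBasis, oi, Nat.not_odd_iff_even.mpr ej, if_true, if_false]
    module
  · refine ⟨i, j, ⟨hi, hin⟩, ⟨hj, hjn⟩, ?_⟩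
    simp [signedBasis, oi, oj]
  · refine ⟨i, j, ⟨hi, hin⟩, ⟨hj, hjn⟩, ?_⟩
    simp only [signedBasis, Nat.not_odd_iff_even.mpr ei, Nat.not_odd_iff_even.mpr ej, if_false]
    module
  · refine ⟨i, i, ⟨hi, hin⟩, ⟨hi, hin⟩, ?_⟩
    simp only [signedBasis, oi, if_true]
    module
  · refine ⟨i, i, ⟨hi, hin⟩, ⟨hi, hin⟩, ?_⟩
    simp only [signedBasis, Nat.not_odd_iff_even.mpr ei, if_false]
    module

lemma neg_mem_PhiC {n : ℕ} {v : ℕ → ℝ} (hv : v ∈ PhiC n) : -v ∈ PhiC n := by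
  rcases hv with ⟨i, j, hi, hin, hj, hjn, hij, rfl | rfl | rfl⟩ | ⟨i, hi, hin, rfl | rfl⟩
  · exact Or.inl ⟨j, i, hj, hjn, hi, hin, hij.symm, Or.inl (by module)⟩
  · exact Or.inl ⟨i, j, hi, hin, hj, hjn, hij, Or.inr (Or.inr (by module))⟩
  · exact Or.inl ⟨i, j, hi, hin, hj, hjn, hij, Or.inr (Or.inl (by module))⟩
  · exact Or.inr ⟨i, hi, hin, Or.inr rfl⟩
  · exact Or.inr ⟨i, hi, hin, Or.inl (neg_neg _)⟩

lemma EC_subset_PhiC (n : ℕ) : EC n ⊆ PhiC n := by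
  rintro v ((((⟨i, j, hi, hin, hj, hjn, oi, ej, rfl⟩ |
    ⟨i, j, hi, hin, hj, hjn, hij, -, -, rfl⟩) | ⟨i, j, hi, hin, hj, hjn, hij, -, -, rfl⟩) |
    ⟨i, hi, hin, -, rfl⟩) | ⟨i, hi, hin, -, rfl⟩)
  · refine Or.inl ⟨i, j, hi, hin, hj, hjn, ?_, Or.inl rfl⟩
    rintro rfl
    exact Nat.not_odd_iff_even.mpr ej oi
  · exact Or.inl ⟨i, j, hi, hin, hj, hjn, hij, Or.inr (Or.inl rfl)⟩
  · exact Or.inl ⟨i, j, hi, hin, hj, hjn, hij, Or.inr (Or.inr rfl)⟩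
  · exact Or.inr ⟨i, hi, hin, Or.inl rfl⟩
  · exact Or.inr ⟨i, hi, hin, Or.inr rfl⟩

lemma signedBasis_sub_mem_PhiC {n i j : ℕ} (hi : 1 ≤ i ∧ i ≤ n) (hj : 1 ≤ j ∧ j ≤ n)
    (hij : i ≠ j) : signedBasis i - signedBasis j ∈ PhiC n := by
  obtain ⟨hi1, hin⟩ := hi
  obtain ⟨hj1, hjn⟩ := hj
  by_cases oi : Odd i <;> by_cases oj : Odd j <;>
    simp only [signedBasis, oi, oj, if_true, if_false]
  · exact Or.inl ⟨i, j, hi1, hin, hj1, hjn, hij, Or.inl rfl⟩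
  · exact Or.inl ⟨i, j, hi1, hin, hj1, hjn, hij, Or.inr (Or.inl (by module))⟩
  · exact Or.inl ⟨i, j, hi1, hin, hj1, hjn, hij, Or.inr (Or.inr rfl)⟩
  · exact Or.inl ⟨j, i, hj1, hjn, hi1, hin, hij.symm, Or.inl (by module)⟩

/-- Every root lies in `EC n`, or its negative does, or it is a difference of two distinct
vectors of the signed basis. -/
lemma mem_EC_or_neg_mem_EC_or_eq_sub {n : ℕ} {v : ℕ → ℝ} (hv : v ∈ PhiC n) :
    v ∈ EC n ∨ -v ∈ EC n ∨
      ∃ i j, (1 ≤ i ∧ i ≤ n) ∧ (1 ≤ j ∧ j ≤ n) ∧ i ≠ j ∧ v = signedBasis i - signedBasis j := by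
  rcases hv with ⟨i, j, hi, hin, hj, hjn, hij, h⟩ | ⟨i, hi, hin, h⟩
  · have hE := signedBasis_add_mem_EC ⟨hi, hin⟩ ⟨hj, hjn⟩
    have hS : ∀ w, w = signedBasis i - signedBasis j ∨ w = signedBasis j - signedBasis i →
        ∃ k l, (1 ≤ k ∧ k ≤ n) ∧ (1 ≤ l ∧ l ≤ n) ∧ k ≠ l ∧ w = signedBasis k - signedBasis l := by
      rintro w (h | h)
      · exact ⟨i, j, ⟨hi, hin⟩, ⟨hj, hjn⟩, hij, h⟩
      · exact ⟨j, i, ⟨hj, hjn⟩, ⟨hi, hin⟩, hij.symm, h⟩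
    by_cases oi : Odd i <;> by_cases oj : Odd j <;>
      simp only [signedBasis, oi, oj, if_true, if_false] at hE hS <;>
      simp only [signedBasis] <;> rcases h with rfl | rfl | rfl
    · exact Or.inr (Or.inr (hS _ (Or.inl (by module))))
    · exact Or.inl hE
    · exact Or.inr (Or.inl (by convert hE using 1; module))
    · exact Or.inl (by convert hE using 1; module)
    · exact Or.inr (Or.inr (hS _ (Or.inl (by module))))
    · exact Or.inr (Or.inr (hS _ (Or.inr (by module))))
    · exact Or.inr (Or.inl (by convert hE using 1; module))
    · exact Or.inr (Or.inr (hS _ (Or.inr (by module))))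
    · exact Or.inr (Or.inr (hS _ (Or.inl (by module))))
    · exact Or.inr (Or.inr (hS _ (Or.inr (by module))))
    · exact Or.inr (Or.inl (by convert hE using 1; module))
    · exact Or.inl (by convert hE using 1; module)
  · have hE := signedBasis_add_mem_EC ⟨hi, hin⟩ ⟨hi, hin⟩
    by_cases oi : Odd i <;> simp only [signedBasis, oi, if_true, if_false] at hE <;>
      rcases h with rfl | rfl
    · exact Or.inl (by convert hE using 1; module)
    · exact Or.inr (Or.inl (by convert hE using 1; module))
    · exact Or.inr (Or.inl (by convert hE using 1; module))
    · exact Or.inl (by convert hE using 1; module)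

lemma abs_add_abs_le_two_of_mem_PhiC {n : ℕ} {v : ℕ → ℝ} (hv : v ∈ PhiC n) {k l : ℕ}
    (hkl : k ≠ l) : |v k| + |v l| ≤ 2 := by
  have h0 (i m : ℕ) : 0 ≤ e i m := by
    unfold e
    rw [Pi.single_apply]
    split_ifs <;> norm_num
  have h1 (i : ℕ) : e i k + e i l ≤ 1 := by
    unfold e
    rw [Pi.single_apply, Pi.single_apply]
    split_ifs with hk hl <;> first | exact absurd (hk.trans hl.symm) hkl | norm_num
  rcases hv with ⟨i, j, -, -, -, -, -, h⟩ | ⟨i, -, -, h⟩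
  · have := h0 i k
    have := h0 i l
    have := h0 j k
    have := h0 j l
    have := h1 i
    have := h1 j
    rcases h with rfl | rfl | rfl <;>
      simp only [Pi.sub_apply, Pi.add_apply, Pi.neg_apply] <;>
      rcases abs_cases (_ : ℝ) with ⟨h2, -⟩ | ⟨h2, -⟩ <;> rw [h2] <;>
      rcases abs_cases (_ : ℝ) with ⟨h3, -⟩ | ⟨h3, -⟩ <;> rw [h3] <;> linarith
  · have := h0 i k
    have := h0 i l
    have := h1 i
    rcases h with rfl | rfl <;>
      simp only [Pi.smul_apply, Pi.neg_apply, smul_eq_mul, abs_neg] <;>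
      rw [abs_of_nonneg (by linarith), abs_of_nonneg (by linarith)] <;> linarith

/-- Lemma A.2 of the paper (combinatorial form), for the root system of type `Cₙ`. -/
theorem stmt_2 (n : ℕ) (hn : 3 ≤ n) :
    ∀ φ ∈ EC n, ∀ ψ ∈ PhiC n, ψ ∉ EC n → ψ ≠ φ → ψ - φ ∉ PhiC n →
      ∃ ω ∈ EC n,
        (ω + ψ ∈ PhiC n ∧ ω + ψ ≠ φ ∧ (ω + ψ) - φ ∉ PhiC n) ∨
        (ω = -ψ ∧ ψ ≠ -φ) := by
  intro φ hφ ψ hψ hψE _ hsub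
  obtain ⟨a, b, ha, hb, rfl⟩ := exists_signedBasis_add_of_mem_EC hφ
  rcases mem_EC_or_neg_mem_EC_or_eq_sub hψ with h | h | ⟨i, j, hi, hj, -, rfl⟩
  · exact absurd h hψE
  · by_cases hneg : ψ = -(signedBasis a + signedBasis b)
    · subst hneg
      obtain ⟨c, hc, hca, hcb⟩ : ∃ c, (1 ≤ c ∧ c ≤ n) ∧ c ≠ a ∧ c ≠ b := by
        by_cases h1 : 1 ≠ a ∧ 1 ≠ b
        · exact ⟨1, by omega, h1⟩
        by_cases h2 : 2 ≠ a ∧ 2 ≠ b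
        · exact ⟨2, by omega, h2⟩
        exact ⟨3, by omega, by omega, by omega⟩
      refine ⟨_, signedBasis_add_mem_EC ha hc, Or.inl ⟨?_, fun h => ?_, fun h => ?_⟩⟩
      · convert signedBasis_sub_mem_PhiC hc hb hcb using 1
        module
      · have := congrFun h c
        simp only [Pi.add_apply, Pi.neg_apply, signedBasis_apply, hca.symm, hcb.symm,
          if_false, if_true] at this
        split_ifs at this <;> norm_num at this
      · have := abs_add_abs_le_two_of_mem_PhiC h hcb
        simp only [Pi.add_apply, Pi.sub_apply, Pi.neg_apply, signedBasis_apply, hca.symm,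
          hcb.symm, hcb, if_false, if_true] at this
        split_ifs at this <;> norm_num at this
    · exact ⟨_, h, Or.inr ⟨rfl, hneg⟩⟩
  · have hia : i ≠ a := by
      rintro rfl
      apply hsub
      convert neg_mem_PhiC (EC_subset_PhiC n (signedBasis_add_mem_EC hj hb)) using 1
      module
    have hib : i ≠ b := by
      rintro rfl
      apply hsub
      convert neg_mem_PhiC (EC_subset_PhiC n (signedBasis_add_mem_EC hj ha)) using 1
      module
    have hsum : signedBasis j + signedBasis i + (signedBasis i - signedBasis j) =
        signedBasis i + signedBasis i := by module
    refine ⟨_, signedBasis_add_mem_EC hj hi, Or.inl ?_⟩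
    rw [hsum]
    refine ⟨EC_subset_PhiC n (signedBasis_add_mem_EC hi hi), fun h => ?_, fun h => ?_⟩
    · have := congrFun h i
      simp only [Pi.add_apply, signedBasis_apply, hia.symm, hib.symm, if_false, if_true] at this
      split_ifs at this <;> norm_num at this
    · have := abs_add_abs_le_two_of_mem_PhiC h hia
      simp only [Pi.add_apply, Pi.sub_apply, signedBasis_apply, hia.symm, hib.symm, hia,
        if_false, if_true] at this
      split_ifs at this <;> norm_num at this
end

section
/- The set E has cardinality n(n+1)/2, and for all φ, ψ ∈ E one has φ + ψ ∉ Φ and φ + ψ ≠ 0. (Consequently, the root vectors {u_φ : φ ∈ E} in a Chevalley basis span an abelian subalgebra of sp(2n,ℝ) of dimension n(n+1)/2.) -/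
/-- The sign attached to an index: `1` for odd indices and `-1` for even ones. -/
noncomputable def paritySign (i : ℕ) : ℝ := if Odd i then 1 else -1

theorem paritySign_mul_self (i : ℕ) : paritySign i * paritySign i = 1 := by
  unfold paritySign; split_ifs <;> norm_num

theorem abs_paritySign (i : ℕ) : |paritySign i| = 1 := by
  unfold paritySign; split_ifs <;> norm_num

/-- The sum of two signed basis vectors, as a function of the unordered pair of indices. -/
noncomputable def signedPairSum : Sym2 ℕ → ℕ → ℝ :=
  Sym2.lift ⟨fun i j => paritySign i • e i + paritySign j • e j, fun _ _ => add_comm _ _⟩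

theorem signedPairSum_mk (i j : ℕ) :
    signedPairSum s(i, j) = paritySign i • e i + paritySign j • e j := rfl

theorem paritySign_mul_signedPairSum (i j k : ℕ) :
    paritySign k * signedPairSum s(i, j) k =
      (if k = i then 1 else 0) + (if k = j then 1 else 0) := by
  have h (a : ℕ) : paritySign k * (paritySign a * e a k) = if k = a then 1 else 0 := by
    by_cases hka : k = a
    · subst hka; simp [e, paritySign_mul_self]
    · simp [e, hka]
  simp [signedPairSum_mk, mul_add, h]

theorem signedPairSum_injective : Function.Injective signedPairSum := by
  intro a b
  induction a with | _ i j
  induction b with | _ k l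
  intro h
  have key (x : ℕ) : ((if x = i then 1 else 0) + (if x = j then 1 else 0) : ℝ) =
      (if x = k then 1 else 0) + (if x = l then 1 else 0) := by
    rw [← paritySign_mul_signedPairSum, ← paritySign_mul_signedPairSum, h]
  have key_nat (x : ℕ) : ((if x = i then 1 else 0) + (if x = j then 1 else 0) : ℕ) =
      (if x = k then 1 else 0) + (if x = l then 1 else 0) := by
    exact_mod_cast key x
  have hi := key_nat i
  have hj := key_nat j
  rw [Sym2.eq_iff]
  grind

theorem EC_eq_image (n : ℕ) : EC n = signedPairSum '' ((Finset.Icc 1 n).sym2 : Set (Sym2 ℕ)) := by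
  have odd_sign {i : ℕ} (h : Odd i) : paritySign i = 1 := if_pos h
  have even_sign {i : ℕ} (h : Even i) : paritySign i = -1 := if_neg (Nat.not_odd_iff_even.2 h)
  have mem {i j : ℕ} (hi : 1 ≤ i) (hin : i ≤ n) (hj : 1 ≤ j) (hjn : j ≤ n) :
      s(i, j) ∈ ((Finset.Icc 1 n).sym2 : Set (Sym2 ℕ)) := by
    simp [*]
  ext v
  constructor
  · rintro ((((⟨i, j, hi, hin, hj, hjn, oi, oj, rfl⟩ | ⟨i, j, hi, hin, hj, hjn, -, oi, oj, rfl⟩) |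
      ⟨i, j, hi, hin, hj, hjn, -, oi, oj, rfl⟩) | ⟨i, hi, hin, oi, rfl⟩) | ⟨i, hi, hin, oi, rfl⟩)
    · exact ⟨_, mem hi hin hj hjn, by
        rw [signedPairSum_mk, odd_sign oi, even_sign oj]; module⟩
    · exact ⟨_, mem hi hin hj hjn, by
        rw [signedPairSum_mk, odd_sign oi, odd_sign oj]; module⟩
    · exact ⟨_, mem hi hin hj hjn, by
        rw [signedPairSum_mk, even_sign oi, even_sign oj]; module⟩
    · exact ⟨_, mem hi hin hi hin, by rw [signedPairSum_mk, odd_sign oi]; module⟩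
    · exact ⟨_, mem hi hin hi hin, by rw [signedPairSum_mk, even_sign oi]; module⟩
  · rintro ⟨s, hs, rfl⟩
    induction s with | _ i j
    simp only [Finset.mem_coe, Finset.mk_mem_sym2_iff, Finset.mem_Icc] at hs
    obtain ⟨⟨hi, hin⟩, hj, hjn⟩ := hs
    rw [signedPairSum_mk]
    rcases Nat.even_or_odd i with oi | oi <;> rcases Nat.even_or_odd j with oj | oj
    · rw [even_sign oi, even_sign oj]
      by_cases hij : i = j
      · subst hij
        exact Or.inr ⟨i, hi, hin, oi, by module⟩
      · exact Or.inl (Or.inl (Or.inr ⟨i, j, hi, hin, hj, hjn, hij, oi, oj, by module⟩))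
    · rw [even_sign oi, odd_sign oj]
      exact Or.inl (Or.inl (Or.inl (Or.inl ⟨j, i, hj, hjn, hi, hin, oj, oi, by module⟩)))
    · rw [odd_sign oi, even_sign oj]
      exact Or.inl (Or.inl (Or.inl (Or.inl ⟨i, j, hi, hin, hj, hjn, oi, oj, by module⟩)))
    · rw [odd_sign oi, odd_sign oj]
      by_cases hij : i = j
      · subst hij
        exact Or.inl (Or.inr ⟨i, hi, hin, oi, by module⟩)
      · exact Or.inl (Or.inl (Or.inl (Or.inr ⟨i, j, hi, hin, hj, hjn, hij, oi, oj, by module⟩)))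

/-- The linear functional `v ↦ ∑ ± vₖ` over `1 ≤ k ≤ n`, with the sign of `k` as coefficient. -/
noncomputable def signedSum (n : ℕ) : (ℕ → ℝ) →ₗ[ℝ] ℝ :=
  ∑ k ∈ Finset.Icc 1 n, paritySign k • LinearMap.proj k

theorem signedSum_e {n i : ℕ} (hi : 1 ≤ i) (hin : i ≤ n) : signedSum n (e i) = paritySign i := by
  simp [signedSum, e, Pi.single_apply, hi, hin]

theorem signedSum_of_mem_EC {n : ℕ} {v : ℕ → ℝ} (hv : v ∈ EC n) : signedSum n v = 2 := by
  rw [EC_eq_image] at hv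
  obtain ⟨s, hs, rfl⟩ := hv
  induction s with | _ i j
  simp only [Finset.mem_coe, Finset.mk_mem_sym2_iff, Finset.mem_Icc] at hs
  simp only [signedPairSum_mk, map_add, map_smul, signedSum_e hs.1.1 hs.1.2,
    signedSum_e hs.2.1 hs.2.2, smul_eq_mul, paritySign_mul_self]
  norm_num

theorem signedSum_le_of_mem_PhiC {n : ℕ} {v : ℕ → ℝ} (hv : v ∈ PhiC n) : signedSum n v ≤ 2 := by
  have bound (i : ℕ) : -1 ≤ paritySign i ∧ paritySign i ≤ 1 := abs_le.1 (abs_paritySign i).le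
  rcases hv with ⟨i, j, hi, hin, hj, hjn, -, rfl | rfl | rfl⟩ | ⟨i, hi, hin, rfl | rfl⟩ <;>
    simp only [map_add, map_sub, map_neg, map_smul, signedSum_e, smul_eq_mul, *]
  · linarith [bound i, bound j]
  · linarith [bound i, bound j]
  · linarith [bound i, bound j]
  · linarith [bound i]
  · linarith [bound i]

/-- Section 3.6, item 3, of the paper: the set `E` of type `Cₙ` has cardinality
`n(n+1)/2`, and for all `φ, ψ ∈ E` one has `φ + ψ ∉ Φ` and `φ + ψ ≠ 0`. -/
theorem stmt_8 (n : ℕ) (hn : 3 ≤ n) :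
    (EC n).ncard = n * (n + 1) / 2 ∧
    ∀ φ ∈ EC n, ∀ ψ ∈ EC n, φ + ψ ∉ PhiC n ∧ φ + ψ ≠ 0 := by
  refine ⟨?_, fun φ hφ ψ hψ => ?_⟩
  · rw [EC_eq_image, Set.ncard_image_of_injective _ signedPairSum_injective,
      Set.ncard_coe_finset, Finset.card_sym2, Nat.card_Icc, Nat.choose_two_right]
    simp [mul_comm]
  · have hsum : signedSum n (φ + ψ) = 4 := by
      rw [map_add, signedSum_of_mem_EC hφ, signedSum_of_mem_EC hψ]; norm_num
    refine ⟨fun h => ?_, fun h => ?_⟩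
    · linarith [signedSum_le_of_mem_PhiC h]
    · simp [h] at hsum
end

section
/- The set D has cardinality n(n−1)/2 + 1, and for all φ, ψ ∈ D one has φ + ψ ∉ Φ and φ + ψ ≠ 0. (Consequently, the corresponding root vectors span an abelian subalgebra of the split Lie algebra of type Bₙ of dimension n(n−1)/2 + 1.) -/
/-- The root system of type `Bₙ`: `{eᵢ - eⱼ, eᵢ + eⱼ, -eᵢ - eⱼ : i ≠ j} ∪ {±eᵢ}`,
indices between `1` and `n`. -/
def PhiB (n : ℕ) : Set (ℕ → ℝ) :=
  {v | ∃ i j : ℕ, 1 ≤ i ∧ i ≤ n ∧ 1 ≤ j ∧ j ≤ n ∧ i ≠ j ∧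
      (v = e i - e j ∨ v = e i + e j ∨ v = -e i - e j)} ∪
  {v | ∃ i : ℕ, 1 ≤ i ∧ i ≤ n ∧ (v = e i ∨ v = -e i)}

/-- The distinguished subset `D ⊆ Φ` of type `Bₙ`:
`{e₁} ∪ {eᵢ - eⱼ : i odd, j even} ∪ {eₘ + eₚ : m ≠ p odd} ∪ {-eₖ - eₗ : k ≠ l even}`,
indices between `1` and `n`. -/
def DB (n : ℕ) : Set (ℕ → ℝ) :=
  {e 1} ∪
  {v | ∃ i j : ℕ, 1 ≤ i ∧ i ≤ n ∧ 1 ≤ j ∧ j ≤ n ∧ Odd i ∧ Even j ∧ v = e i - e j} ∪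
  {v | ∃ m p : ℕ, 1 ≤ m ∧ m ≤ n ∧ 1 ≤ p ∧ p ≤ n ∧ m ≠ p ∧ Odd m ∧ Odd p ∧
      v = e m + e p} ∪
  {v | ∃ k l : ℕ, 1 ≤ k ∧ k ≤ n ∧ 1 ≤ l ∧ l ≤ n ∧ k ≠ l ∧ Even k ∧ Even l ∧
      v = -e k - e l}

/-- The vector supported on `s` with entry `1` at odd and `-1` at even indices of `s`. -/
def alternatingIndicator (s : Finset ℕ) : ℕ → ℝ := fun i => if i ∈ s then -(-1) ^ i else 0

theorem alternatingIndicator_injective : Function.Injective alternatingIndicator := by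
  have mem_iff (s : Finset ℕ) (i : ℕ) : i ∈ s ↔ alternatingIndicator s i ≠ 0 := by
    simp [alternatingIndicator]
  intro s t h
  ext i
  rw [mem_iff, mem_iff, h]

theorem alternatingIndicator_singleton (i : ℕ) :
    alternatingIndicator {i} = (-(-1) ^ i : ℝ) • e i := by
  ext k
  by_cases hk : k = i <;> simp [alternatingIndicator, e, hk]

theorem alternatingIndicator_pair {i j : ℕ} (hij : i ≠ j) :
    alternatingIndicator {i, j} = (-(-1) ^ i : ℝ) • e i + (-(-1) ^ j : ℝ) • e j := by
  ext k
  by_cases hi : k = i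
  · subst hi
    simp [alternatingIndicator, e, hij]
  · by_cases hj : k = j <;> simp [alternatingIndicator, e, Pi.single_apply, hi, hj]
    subst hj
    simp [hi]

theorem DB_eq_image (n : ℕ) :
    DB n = alternatingIndicator '' ↑(insert {1} ((Finset.Icc 1 n).powersetCard 2)) := by
  have pair_mem {i j : ℕ} (hi : 1 ≤ i) (hi' : i ≤ n) (hj : 1 ≤ j) (hj' : j ≤ n) (hij : i ≠ j) :
      ({i, j} : Finset ℕ) ∈ insert {1} ((Finset.Icc 1 n).powersetCard 2) := by
    simp only [Finset.mem_insert, Finset.mem_powersetCard]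
    refine Or.inr ⟨fun k hk => ?_, Finset.card_pair hij⟩
    simp only [Finset.mem_insert, Finset.mem_singleton] at hk
    rw [Finset.mem_Icc]
    omega
  ext v
  constructor
  · rintro (((rfl | ⟨i, j, hi, hi', hj, hj', oi, ej, rfl⟩) |
      ⟨i, j, hi, hi', hj, hj', hij, oi, oj, rfl⟩) |
      ⟨i, j, hi, hi', hj, hj', hij, ei, ej, rfl⟩)
    · exact ⟨{1}, by simp, by simp [alternatingIndicator_singleton]⟩
    · have hij : i ≠ j := by
        rintro rfl
        exact Nat.not_even_iff_odd.2 oi ej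
      refine ⟨{i, j}, pair_mem hi hi' hj hj' hij, ?_⟩
      simp [alternatingIndicator_pair hij, oi.neg_one_pow, ej.neg_one_pow, sub_eq_add_neg]
    · refine ⟨{i, j}, pair_mem hi hi' hj hj' hij, ?_⟩
      simp [alternatingIndicator_pair hij, oi.neg_one_pow, oj.neg_one_pow]
    · refine ⟨{i, j}, pair_mem hi hi' hj hj' hij, ?_⟩
      simp [alternatingIndicator_pair hij, ei.neg_one_pow, ej.neg_one_pow, sub_eq_add_neg]
  · rintro ⟨s, hs, rfl⟩
    rw [Finset.mem_coe, Finset.mem_insert, Finset.mem_powersetCard] at hs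
    rcases hs with rfl | ⟨hs, hcard⟩
    · exact Or.inl (Or.inl (Or.inl (by simp [alternatingIndicator_singleton])))
    · obtain ⟨i, j, hij, rfl⟩ := Finset.card_eq_two.1 hcard
      obtain ⟨hi, hi'⟩ := Finset.mem_Icc.1 (hs (Finset.mem_insert_self i {j}))
      obtain ⟨hj, hj'⟩ := Finset.mem_Icc.1
        (hs (Finset.mem_insert_of_mem (Finset.mem_singleton_self j)))
      rw [alternatingIndicator_pair hij]
      rcases Nat.even_or_odd i with pi | pi <;> rcases Nat.even_or_odd j with pj | pj <;>
        simp only [pi.neg_one_pow, pj.neg_one_pow, neg_neg, one_smul, neg_smul]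
      · exact Or.inr ⟨i, j, hi, hi', hj, hj', hij, pi, pj, by rw [sub_eq_add_neg]⟩
      · exact Or.inl (Or.inl (Or.inr ⟨j, i, hj, hj', hi, hi', pj, pi, by abel⟩))
      · exact Or.inl (Or.inl (Or.inr ⟨i, j, hi, hi', hj, hj', pi, pj, by abel⟩))
      · exact Or.inl (Or.inr ⟨i, j, hi, hi', hj, hj', hij, pi, pj, rfl⟩)

theorem ncard_DB (n : ℕ) : (DB n).ncard = n * (n - 1) / 2 + 1 := by
  rw [DB_eq_image, Set.ncard_image_of_injective _ alternatingIndicator_injective,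
    Set.ncard_coe_finset, Finset.card_insert_of_notMem (by simp [Finset.mem_powersetCard]),
    Finset.card_powersetCard, Nat.card_Icc, Nat.add_sub_cancel, Nat.choose_two_right]

/-- The linear functional `v ↦ v₁ - v₂ + v₃ - ⋯ ± vₙ`. -/
def alternatingSum (n : ℕ) : (ℕ → ℝ) →ₗ[ℝ] ℝ :=
  ∑ i ∈ Finset.Icc 1 n, (-(-1) ^ i : ℝ) • LinearMap.proj i

theorem alternatingSum_e {n i : ℕ} (hi : 1 ≤ i) (hi' : i ≤ n) :
    alternatingSum n (e i) = -(-1) ^ i := by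
  simp [alternatingSum, e, Pi.single_apply, hi, hi']

theorem alternatingSum_alternatingIndicator {n : ℕ} {s : Finset ℕ} (hs : s ⊆ Finset.Icc 1 n) :
    alternatingSum n (alternatingIndicator s) = s.card := by
  simp [alternatingSum, alternatingIndicator, ← mul_pow, Finset.inter_eq_right.2 hs]

theorem eq_e_one_or_alternatingSum_eq_two {n : ℕ} {φ : ℕ → ℝ} (h : φ ∈ DB n) :
    φ = e 1 ∨ alternatingSum n φ = 2 := by
  rw [DB_eq_image] at h
  obtain ⟨s, hs, rfl⟩ := h
  rw [Finset.mem_coe, Finset.mem_insert, Finset.mem_powersetCard] at hs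
  rcases hs with rfl | ⟨hs, hcard⟩
  · exact Or.inl (by simp [alternatingIndicator_singleton])
  · exact Or.inr (by simp [alternatingSum_alternatingIndicator hs, hcard])

theorem alternatingSum_le_two {n : ℕ} {φ : ℕ → ℝ} (h : φ ∈ PhiB n) : alternatingSum n φ ≤ 2 := by
  rcases h with ⟨i, j, hi, hi', hj, hj', -, h⟩ | ⟨i, hi, hi', h⟩
  · rcases neg_one_pow_eq_or ℝ i with pi | pi <;> rcases neg_one_pow_eq_or ℝ j with pj | pj <;>
      rcases h with rfl | rfl | rfl <;>
      simp only [map_add, map_sub, map_neg, alternatingSum_e hi hi', alternatingSum_e hj hj', pi,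
        pj] <;> norm_num
  · rcases neg_one_pow_eq_or ℝ i with pi | pi <;> rcases h with rfl | rfl <;>
      simp only [map_neg, alternatingSum_e hi hi', pi] <;> norm_num

theorem apply_le_one_of_mem_PhiB {n : ℕ} {φ : ℕ → ℝ} (h : φ ∈ PhiB n) (k : ℕ) : φ k ≤ 1 := by
  rcases h with ⟨i, j, -, -, -, -, hij, rfl | rfl | rfl⟩ | ⟨i, -, -, rfl | rfl⟩ <;>
    simp only [e, Pi.single_apply, Pi.add_apply, Pi.sub_apply, Pi.neg_apply] <;>
    split_ifs <;> first | omega | norm_num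

/-- Section 3.6, item 2, of the paper: the set `D` of type `Bₙ` has cardinality
`n(n-1)/2 + 1`, and for all `φ, ψ ∈ D` one has `φ + ψ ∉ Φ` and `φ + ψ ≠ 0`. -/
theorem stmt_9 (n : ℕ) (hn : 5 ≤ n) :
    (DB n).ncard = n * (n - 1) / 2 + 1 ∧
    ∀ φ ∈ DB n, ∀ ψ ∈ DB n, φ + ψ ∉ PhiB n ∧ φ + ψ ≠ 0 := by
  refine ⟨ncard_DB n, fun φ hφ ψ hψ => ?_⟩
  have he : alternatingSum n (e 1) = 1 := by
    simp [alternatingSum_e le_rfl (show 1 ≤ n by omega)]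
  have one_le {χ : ℕ → ℝ} (hχ : χ ∈ DB n) : 1 ≤ alternatingSum n χ := by
    rcases eq_e_one_or_alternatingSum_eq_two hχ with rfl | h
    · exact he.ge
    · linarith
  have hφ₁ := one_le hφ
  have hψ₁ := one_le hψ
  refine ⟨fun hmem => ?_, fun h0 => ?_⟩
  · have hle := alternatingSum_le_two hmem
    rw [map_add] at hle
    rcases eq_e_one_or_alternatingSum_eq_two hφ with rfl | h
    · rcases eq_e_one_or_alternatingSum_eq_two hψ with rfl | h
      · have h1 := apply_le_one_of_mem_PhiB hmem 1
        norm_num [e] at h1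
      · linarith
    · linarith
  · have hsum := congrArg (alternatingSum n) h0
    rw [map_add, map_zero] at hsum
    linarith
end

section
/- The set D has cardinality 9, and for all φ, ψ ∈ D one has φ + ψ ∉ Φ and φ + ψ ≠ 0. (Consequently, the corresponding root vectors span an abelian subalgebra of the split Lie algebra of type F₄ of dimension 9.) -/
/-- The root system of type `F₄` in `ℝ⁴`:
`{±eᵢ} ∪ {±eᵢ ± eⱼ : i < j} ∪ {½(±e₁ ± e₂ ± e₃ ± e₄)}` (all sign choices). -/
def PhiF : Set (ℕ → ℝ) :=
  {v | ∃ i : ℕ, 1 ≤ i ∧ i ≤ 4 ∧ (v = e i ∨ v = -e i)} ∪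
  {v | ∃ i j : ℕ, 1 ≤ i ∧ i < j ∧ j ≤ 4 ∧
      (v = e i + e j ∨ v = e i - e j ∨ v = -e i + e j ∨ v = -e i - e j)} ∪
  {v | ∃ c₁ c₂ c₃ c₄ : ℝ, (c₁ = 1 ∨ c₁ = -1) ∧ (c₂ = 1 ∨ c₂ = -1) ∧
      (c₃ = 1 ∨ c₃ = -1) ∧ (c₄ = 1 ∨ c₄ = -1) ∧
      v = (1 / 2 : ℝ) • (c₁ • e 1 + c₂ • e 2 + c₃ • e 3 + c₄ • e 4)}

/-- The distinguished subset `D ⊆ Φ` of type `F₄` (Section 3.6, item 8, of the paper). -/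
def DF : Set (ℕ → ℝ) :=
  {e 1, e 1 - e 2, e 1 - e 4, e 3 - e 2, e 3 - e 4, -e 2 - e 4, e 1 + e 3,
   (1 / 2 : ℝ) • (e 1 - e 2 + e 3 - e 4), (1 / 2 : ℝ) • (e 1 + e 2 + e 3 - e 4)}

/-- The squared Euclidean length of the projection to the coordinates `1, 2, 3, 4`. -/
def sqLength (v : ℕ → ℝ) : ℝ := v 1 ^ 2 + v 2 ^ 2 + v 3 ^ 2 + v 4 ^ 2

lemma sqLength_le_two_of_mem_PhiF {v : ℕ → ℝ} (hv : v ∈ PhiF) : sqLength v ≤ 2 := by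
  rcases hv with (⟨i, hi, hi', h⟩ | ⟨i, j, hi, hij, hj, h⟩) | ⟨c₁, c₂, c₃, c₄, h₁, h₂, h₃, h₄, rfl⟩
  · interval_cases i <;> rcases h with rfl | rfl <;> norm_num [sqLength, e, Pi.single_apply]
  · have hi' : i ≤ 4 := by omega
    have hj' : 1 ≤ j := by omega
    interval_cases i <;> interval_cases j <;> first
      | omega
      | rcases h with rfl | rfl | rfl | rfl <;> norm_num [sqLength, e, Pi.single_apply]
  · rw [← mul_self_eq_one_iff] at h₁ h₂ h₃ h₄
    simp only [sqLength, e, Pi.smul_apply, Pi.add_apply, Pi.single_apply, smul_eq_mul]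
    norm_num
    linarith

lemma two_lt_sqLength_add {φ ψ : ℕ → ℝ} (hφ : φ ∈ DF) (hψ : ψ ∈ DF) : 2 < sqLength (φ + ψ) := by
  simp only [DF, Set.mem_insert_iff, Set.mem_singleton_iff] at hφ hψ
  rcases hφ with rfl | rfl | rfl | rfl | rfl | rfl | rfl | rfl | rfl <;>
  rcases hψ with rfl | rfl | rfl | rfl | rfl | rfl | rfl | rfl | rfl <;>
  norm_num [sqLength, e, Pi.single_apply]

lemma ncard_DF : DF.ncard = 9 := by
  have h (v w : ℕ → ℝ) (hvw : v 1 + 3 * v 2 + 7 * v 3 + 20 * v 4 ≠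
      w 1 + 3 * w 2 + 7 * w 3 + 20 * w 4) : v ≠ w := by
    rintro rfl
    exact hvw rfl
  unfold DF
  repeat rw [Set.ncard_insert_of_notMem]
  · rw [Set.ncard_singleton]
  all_goals
    simp only [Set.mem_insert_iff, Set.mem_singleton_iff, not_or]
    (repeat' apply And.intro) <;> apply h <;> norm_num [e, Pi.single_apply]

/-- Section 3.6, item 8, of the paper: the set `D` of type `F₄` has cardinality `9`,
and for all `φ, ψ ∈ D` one has `φ + ψ ∉ Φ` and `φ + ψ ≠ 0`. -/
theorem stmt_11 :
    DF.ncard = 9 ∧ ∀ φ ∈ DF, ∀ ψ ∈ DF, φ + ψ ∉ PhiF ∧ φ + ψ ≠ 0 := by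
  refine ⟨ncard_DF, fun φ hφ ψ hψ ↦ ?_⟩
  have hlt := two_lt_sqLength_add hφ hψ
  refine ⟨fun h ↦ hlt.not_ge (sqLength_le_two_of_mem_PhiF h), fun h ↦ ?_⟩
  rw [h] at hlt
  norm_num [sqLength] at hlt
end
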